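/- arXiv:1104.2463 — 5 statements merged into one kernel-verified Lean document; each statement's English description precedes it below -/
import Mathlib

section
/- A normed space P is extremely projective in Nor if and only if P is a near-retract (in the category of normed spaces and bounded operators) of l₁⁰(Λ) for some index set Λ. -/
noncomputable section

/-- A coisometric (quotient) bounded operator between complex normed spaces. -/
def IsCoisometry {Y X : Type} [NormedAddCommGroup Y] [NormedSpace ℂ Y]
    [NormedAddCommGroup X] [NormedSpace ℂ X] (τ : Y →L[ℂ] X) : Prop :=
  (∀ y : Y, ‖τ y‖ ≤ ‖y‖) ∧ ∀ x : X, ∀ ε : ℝ, 0 < ε → ∃ y : Y, τ y = x ∧ ‖y‖ < ‖x‖ + ε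

/-- Extreme (metric) projectivity in the category Nor of all complex normed spaces. -/
def ExtremelyProjectiveNor (P : Type) [NormedAddCommGroup P] [NormedSpace ℂ P] : Prop :=
  ∀ (Y X : Type) [NormedAddCommGroup Y] [NormedSpace ℂ Y]
    [NormedAddCommGroup X] [NormedSpace ℂ X],
    ∀ τ : Y →L[ℂ] X, IsCoisometry τ →
      ∀ φ : P →L[ℂ] X, ∀ ε : ℝ, 0 < ε →
        ∃ ψ : P →L[ℂ] Y, τ.comp ψ = φ ∧ ‖ψ‖ < ‖φ‖ + ε

/-- `σ : Y → X` is a near-retraction: it is contractive and for every `δ > 0` it has a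
bounded right inverse of norm `< 1 + δ`. -/
def IsNearRetraction {Y X : Type} [NormedAddCommGroup Y] [NormedSpace ℂ Y]
    [NormedAddCommGroup X] [NormedSpace ℂ X] (σ : Y →L[ℂ] X) : Prop :=
  (∀ y : Y, ‖σ y‖ ≤ ‖y‖) ∧
    ∀ δ : ℝ, 0 < δ → ∃ ρ : X →L[ℂ] Y, σ.comp ρ = ContinuousLinearMap.id ℂ X ∧ ‖ρ‖ < 1 + δ

instance : Fact ((1 : ENNReal) ≤ 1) := ⟨le_rfl⟩

/-- The Banach space `l₁(Λ)` of absolutely summable complex functions on `Λ`. -/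
abbrev l1Space (Λ : Type) : Type := lp (fun _ : Λ => ℂ) 1

/-- The canonical basis vector `e_ν` in `l₁(Λ)`. -/
def l1single (Λ : Type) (ν : Λ) : l1Space Λ :=
  letI : DecidableEq Λ := Classical.decEq Λ
  lp.single 1 ν (1 : ℂ)

/-- The subspace `l₁⁰(Λ)` of finitely supported functions, i.e. the linear span
of the canonical basis vectors, with the `l₁`-norm. -/
def l10 (Λ : Type) : Submodule ℂ (l1Space Λ) :=
  Submodule.span ℂ (Set.range (l1single Λ))

theorem l1single_apply (Λ : Type) (ν μ : Λ) [Decidable (μ = ν)] :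
    l1single Λ ν μ = if μ = ν then 1 else 0 := by
  simp only [l1single, lp.coeFn_single, Pi.single_apply]
  congr

theorem norm_l1single (Λ : Type) (ν : Λ) : ‖l1single Λ ν‖ = 1 := by
  simp [l1single, lp.norm_single]

theorem l1single_mem_l10 (Λ : Type) (ν : Λ) : l1single Λ ν ∈ l10 Λ :=
  Submodule.subset_span ⟨ν, rfl⟩

theorem finite_support_of_mem_l10 {Λ : Type} {f : l1Space Λ} (hf : f ∈ l10 Λ) :
    (Function.support (f : Λ → ℂ)).Finite := by
  classical
  induction hf using Submodule.span_induction with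
  | mem f hf =>
    obtain ⟨ν, rfl⟩ := hf
    refine (Set.finite_singleton ν).subset fun μ hμ => ?_
    by_contra h
    exact hμ (by simpa [l1single_apply] using h)
  | zero => exact Set.finite_empty.subset fun μ hμ => hμ rfl
  | add f g _ _ hf hg =>
    exact (hf.union hg).subset (Function.support_add (f : Λ → ℂ) g)
  | smul c f _ hf =>
    exact hf.subset (Function.support_const_smul_subset c (f : Λ → ℂ))

theorem sum_norm_le_l1_norm {Λ : Type} (f : l1Space Λ) (s : Finset Λ) :
    ∑ ν ∈ s, ‖f ν‖ ≤ ‖f‖ := by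
  simpa using lp.sum_rpow_le_norm_rpow (p := 1) (by simp) f s

/-- A bounded family of vectors extends to a bounded operator on `l₁⁰(Λ)`. -/
theorem exists_l10_extension {Λ E : Type} [NormedAddCommGroup E] [NormedSpace ℂ E]
    (v : Λ → E) {C : ℝ} (hC : 0 ≤ C) (hv : ∀ ν, ‖v ν‖ ≤ C) :
    ∃ T : ↥(l10 Λ) →L[ℂ] E,
      (∀ ν, T ⟨l1single Λ ν, l1single_mem_l10 Λ ν⟩ = v ν) ∧ ‖T‖ ≤ C := by
  classical
  have hfin (f : l10 Λ) : (Function.support fun ν => (f : l1Space Λ) ν • v ν).Finite :=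
    (finite_support_of_mem_l10 f.2).subset (Function.support_smul_subset_left _ _)
  let T : ↥(l10 Λ) →ₗ[ℂ] E :=
    { toFun f := ∑ᶠ ν, (f : l1Space Λ) ν • v ν
      map_add' f g := by
        rw [← finsum_add_distrib (hfin f) (hfin g)]
        simp [add_smul]
      map_smul' c f := by
        rw [RingHom.id_apply, smul_finsum' c (hfin f)]
        simp [mul_smul] }
  have hT (f : l10 Λ) : ‖T f‖ ≤ C * ‖f‖ := by
    change ‖∑ᶠ ν, (f : l1Space Λ) ν • v ν‖ ≤ C * ‖(f : l1Space Λ)‖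
    rw [finsum_eq_sum _ (hfin f)]
    calc
      _ ≤ ∑ ν ∈ (hfin f).toFinset, C * ‖(f : l1Space Λ) ν‖ :=
        norm_sum_le_of_le _ fun ν _ => by
          rw [norm_smul, mul_comm]
          gcongr
          exact hv ν
      _ ≤ _ := by
        rw [← Finset.mul_sum]
        gcongr
        exact sum_norm_le_l1_norm _ _
  refine ⟨T.mkContinuous C hT, fun ν => ?_, T.mkContinuous_norm_le hC hT⟩
  change ∑ᶠ μ, l1single Λ ν μ • v μ = v ν
  rw [finsum_eq_single _ ν fun μ hμ => by simp [l1single_apply, hμ]]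
  simp [l1single_apply]

theorem l10_hom_ext {Λ E : Type} [NormedAddCommGroup E] [NormedSpace ℂ E]
    {S T : ↥(l10 Λ) →L[ℂ] E}
    (h : ∀ ν, S ⟨l1single Λ ν, l1single_mem_l10 Λ ν⟩ =
      T ⟨l1single Λ ν, l1single_mem_l10 Λ ν⟩) : S = T := by
  ext ⟨f, hf⟩
  induction hf using Submodule.span_induction with
  | mem f hf =>
    obtain ⟨ν, rfl⟩ := hf
    exact h ν
  | zero => exact (map_zero S).trans (map_zero T).symm
  | add f g hf hg ihf ihg =>
    exact (map_add S ⟨f, hf⟩ ⟨g, hg⟩).trans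
      ((congrArg₂ (· + ·) ihf ihg).trans (map_add T ⟨f, hf⟩ ⟨g, hg⟩).symm)
  | smul c f hf ih =>
    exact (map_smul S c ⟨f, hf⟩).trans
      ((congrArg (c • ·) ih).trans (map_smul T c ⟨f, hf⟩).symm)

theorem extremelyProjectiveNor_l10 (Λ : Type) : ExtremelyProjectiveNor ↥(l10 Λ) := by
  intro Y X _ _ _ _ τ hτ φ ε hε
  have hφ (ν : Λ) : ‖φ ⟨l1single Λ ν, l1single_mem_l10 Λ ν⟩‖ ≤ ‖φ‖ :=
    φ.unit_le_opNorm _ (norm_l1single Λ ν).le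
  choose y hy hy' using fun ν =>
    hτ.2 (φ ⟨l1single Λ ν, l1single_mem_l10 Λ ν⟩) (ε / 2) (half_pos hε)
  obtain ⟨ψ, hψ, hψ'⟩ := exists_l10_extension y (C := ‖φ‖ + ε / 2) (by positivity)
    fun ν => by linarith [hy' ν, hφ ν]
  refine ⟨ψ, l10_hom_ext fun ν => ?_, by linarith⟩
  rw [ContinuousLinearMap.comp_apply, hψ, hy]

theorem exists_l10_coisometry (P : Type) [NormedAddCommGroup P] [NormedSpace ℂ P] :
    ∃ (Λ : Type) (σ : ↥(l10 Λ) →L[ℂ] P), IsCoisometry σ := by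
  obtain ⟨σ, hσ, hσ'⟩ := exists_l10_extension
    (fun x : Metric.closedBall (0 : P) 1 => (x : P)) zero_le_one
    fun x => mem_closedBall_zero_iff.1 x.2
  refine ⟨_, σ, fun y => by simpa using σ.le_of_opNorm_le hσ' y, fun x ε hε => ?_⟩
  have hx : (‖x‖⁻¹ : ℂ) • x ∈ Metric.closedBall (0 : P) 1 := by
    simpa [norm_smul] using inv_mul_le_one
  refine ⟨(‖x‖ : ℂ) • ⟨l1single _ ⟨_, hx⟩, l1single_mem_l10 _ _⟩, ?_, ?_⟩
  · rw [map_smul, hσ]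
    rcases eq_or_ne x 0 with rfl | h
    · simp
    · exact smul_inv_smul₀ (by simpa using h) x
  · rw [norm_smul, Submodule.coe_norm, norm_l1single]
    simpa using hε

/-- Extreme projectivity passes to near-retracts. -/
theorem ExtremelyProjectiveNor.of_isNearRetraction {Q P : Type}
    [NormedAddCommGroup Q] [NormedSpace ℂ Q] [NormedAddCommGroup P] [NormedSpace ℂ P]
    (hQ : ExtremelyProjectiveNor Q) {σ : Q →L[ℂ] P} (hσ : IsNearRetraction σ) :
    ExtremelyProjectiveNor P := by
  intro Y X _ _ _ _ τ hτ φ ε hε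
  obtain ⟨ψ, hψ, hψ'⟩ := hQ Y X τ hτ (φ.comp σ) (ε / 2) (half_pos hε)
  have hφσ : ‖φ.comp σ‖ ≤ ‖φ‖ :=
    ContinuousLinearMap.opNorm_le_bound _ (norm_nonneg _) fun y =>
      (φ.le_opNorm _).trans (by gcongr; exact hσ.1 y)
  have hC : 0 < ‖φ‖ + ε / 2 := by positivity
  obtain ⟨ρ, hρ, hρ'⟩ := hσ.2 (ε / 2 / (‖φ‖ + ε / 2)) (by positivity)
  refine ⟨ψ.comp ρ, ?_, ?_⟩
  · rw [← ContinuousLinearMap.comp_assoc, hψ, ContinuousLinearMap.comp_assoc, hρ,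
      ContinuousLinearMap.comp_id]
  · calc
      ‖ψ.comp ρ‖ ≤ ‖ψ‖ * ‖ρ‖ := ψ.opNorm_comp_le ρ
      _ ≤ (‖φ‖ + ε / 2) * ‖ρ‖ := by gcongr; linarith
      _ < (‖φ‖ + ε / 2) * (1 + ε / 2 / (‖φ‖ + ε / 2)) := by gcongr
      _ = ‖φ‖ + ε := by field_simp; ring

theorem IsCoisometry.isNearRetraction {Y P : Type}
    [NormedAddCommGroup Y] [NormedSpace ℂ Y] [NormedAddCommGroup P] [NormedSpace ℂ P]
    (hP : ExtremelyProjectiveNor P) {σ : Y →L[ℂ] P} (hσ : IsCoisometry σ) :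
    IsNearRetraction σ := by
  refine ⟨hσ.1, fun δ hδ => ?_⟩
  obtain ⟨ρ, hρ, hρ'⟩ := hP Y P σ hσ (ContinuousLinearMap.id ℂ P) δ hδ
  exact ⟨ρ, hρ, hρ'.trans_le (by gcongr; exact ContinuousLinearMap.norm_id_le)⟩

/-- A normed space `P` is extremely projective in Nor if and only if it is a near-retract
of `l₁⁰(Λ)` for some index set `Λ`. -/
theorem extremelyProjectiveNor_iff_nearRetract_l10
    (P : Type) [NormedAddCommGroup P] [NormedSpace ℂ P] :
    ExtremelyProjectiveNor P ↔
      ∃ (Λ : Type) (σ : ↥(l10 Λ) →L[ℂ] P), IsNearRetraction σ := by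
  constructor
  · intro hP
    obtain ⟨Λ, σ, hσ⟩ := exists_l10_coisometry P
    exact ⟨Λ, σ, hσ.isNearRetraction hP⟩
  · rintro ⟨Λ, σ, hσ⟩
    exact (extremelyProjectiveNor_l10 Λ).of_isNearRetraction hσ

end
end

section
/- Let A be a sequence algebra and X an essential homogeneous normed A-module. Then X is extremely projective with respect to the class H of all essential homogeneous normed A-modules if and only if: (i) for every n ∈ ℕ the n-th coordinate subspace Xₙ is extremely projective in Nor, and (ii) X is of finite type. Moreover, if X is merely topologically projective with respect to H, then (ii) still holds. -/
noncomputable section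

open Filter Topology

/-- Topological projectivity in Nor. -/
def TopologicallyProjectiveNor (P : Type) [NormedAddCommGroup P] [NormedSpace ℂ P] : Prop :=
  ∀ (Y X : Type) [NormedAddCommGroup Y] [NormedSpace ℂ Y]
    [NormedAddCommGroup X] [NormedSpace ℂ X],
    ∀ τ : Y →L[ℂ] X, IsCoisometry τ →
      ∀ φ : P →L[ℂ] X, ∃ ψ : P →L[ℂ] Y, τ.comp ψ = φ

/-- A (contractive, non-degenerate in no way assumed) normed left module over a
(not necessarily unital) complex normed algebra `A`. -/
structure NormedMod (A : Type) [NonUnitalNormedRing A] [NormedSpace ℂ A] : Type 1 where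
  X : Type
  [grp : NormedAddCommGroup X]
  [sp : NormedSpace ℂ X]
  smul : A → X → X
  smul_add : ∀ (a : A) (x y : X), smul a (x + y) = smul a x + smul a y
  add_smul : ∀ (a b : A) (x : X), smul (a + b) x = smul a x + smul b x
  smul_csmul : ∀ (c : ℂ) (a : A) (x : X), smul a (c • x) = c • smul a x
  csmul_smul : ∀ (c : ℂ) (a : A) (x : X), smul (c • a) x = c • smul a x
  mul_smul : ∀ (a b : A) (x : X), smul (a * b) x = smul a (smul b x)
  norm_smul_le : ∀ (a : A) (x : X), ‖smul a x‖ ≤ ‖a‖ * ‖x‖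

attribute [instance] NormedMod.grp NormedMod.sp

variable {A : Type} [NonUnitalNormedRing A] [NormedSpace ℂ A]
  [IsScalarTower ℂ A A] [SMulCommClass ℂ A A]

/-- Bounded `A`-module morphism property for a bounded operator between the underlying spaces. -/
def IsMor (M N : NormedMod A) (f : M.X →L[ℂ] N.X) : Prop :=
  ∀ (a : A) (x : M.X), f (M.smul a x) = N.smul a (f x)

/-- Extreme (metric) projectivity of a normed `A`-module with respect to a class `K`
of normed `A`-modules. -/
def ExtremelyProjective (P : NormedMod A) (K : NormedMod A → Prop) : Prop :=
  ∀ (MY MX : NormedMod A), K MY → K MX →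
    ∀ τ : MY.X →L[ℂ] MX.X, IsMor MY MX τ → IsCoisometry τ →
      ∀ φ : P.X →L[ℂ] MX.X, IsMor P MX φ → ∀ ε : ℝ, 0 < ε →
        ∃ ψ : P.X →L[ℂ] MY.X, IsMor P MY ψ ∧ τ.comp ψ = φ ∧ ‖ψ‖ < ‖φ‖ + ε

/-- Topological projectivity of a normed `A`-module with respect to a class `K`. -/
def TopologicallyProjective (P : NormedMod A) (K : NormedMod A → Prop) : Prop :=
  ∀ (MY MX : NormedMod A), K MY → K MX →
    ∀ τ : MY.X →L[ℂ] MX.X, IsMor MY MX τ → IsCoisometry τ →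
      ∀ φ : P.X →L[ℂ] MX.X, IsMor P MX φ →
        ∃ ψ : P.X →L[ℂ] MY.X, IsMor P MY ψ ∧ τ.comp ψ = φ

/-- A sequence algebra: a normed algebra `A` realized (injectively, by `coords`) as an
algebra of complex sequences with coordinatewise operations, containing the elements
`p n` (the sequences with a single entry `1` in position `n`, which span `c₀₀`) so that
`c₀₀` is dense and `‖p n‖ = 1`. -/
structure SequenceAlgebra (A : Type) [NonUnitalNormedRing A] [NormedSpace ℂ A] : Type where
  coords : A →ₗ[ℂ] (ℕ → ℂ)
  coords_injective : Function.Injective coords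
  coords_mul : ∀ a b : A, coords (a * b) = coords a * coords b
  p : ℕ → A
  coords_p : ∀ n : ℕ, coords (p n) = fun m => if m = n then (1 : ℂ) else 0
  norm_p : ∀ n : ℕ, ‖p n‖ = 1
  dense_c00 : Dense (↑(Submodule.span ℂ (Set.range p)) : Set A)

variable (SA : SequenceAlgebra A)

/-- The action of a fixed `a : A` as a `ℂ`-linear map on a normed `A`-module. -/
def NormedMod.smulLM (M : NormedMod A) (a : A) : M.X →ₗ[ℂ] M.X where
  toFun := M.smul a
  map_add' := M.smul_add a
  map_smul' := fun c x => M.smul_csmul c a x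

/-- The `n`-th coordinate subspace `Xₙ = {pⁿ · x : x ∈ X}` of a normed `A`-module. -/
def coordSub (M : NormedMod A) (n : ℕ) : Submodule ℂ M.X :=
  LinearMap.range (M.smulLM (SA.p n))

/-- A normed `A`-module is essential (non-degenerate) if the closed linear span of
`{a · x}` is everything. -/
def NormedMod.Essential (M : NormedMod A) : Prop :=
  Dense (↑(Submodule.span ℂ {y : M.X | ∃ (a : A) (x : M.X), y = M.smul a x}) : Set M.X)

/-- Homogeneity: the norm of an element is monotonely determined by the norms of
its coordinates. -/
def Homogeneous (M : NormedMod A) : Prop :=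
  ∀ x y : M.X, (∀ n : ℕ, ‖M.smul (SA.p n) x‖ ≤ ‖M.smul (SA.p n) y‖) → ‖x‖ ≤ ‖y‖

/-- An element is finite if its coordinates eventually vanish. -/
def FiniteElt (M : NormedMod A) (x : M.X) : Prop :=
  ∃ N : ℕ, ∀ n : ℕ, N ≤ n → M.smul (SA.p n) x = 0

/-- A module has finite type if all its elements are finite, i.e. `X = X₀₀`. -/
def FiniteType (M : NormedMod A) : Prop :=
  ∀ x : M.X, FiniteElt SA M x

namespace SequenceAlgebra

omit [IsScalarTower ℂ A A] [SMulCommClass ℂ A A]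


lemma p_mul (a : A) (n : ℕ) : SA.p n * a = SA.coords a n • SA.p n := by
  apply SA.coords_injective
  ext m
  by_cases h : m = n <;> simp [SA.coords_mul, SA.coords_p, h]

lemma mul_p (a : A) (n : ℕ) : a * SA.p n = SA.coords a n • SA.p n := by
  apply SA.coords_injective
  ext m
  by_cases h : m = n <;> simp [SA.coords_mul, SA.coords_p, h]

lemma norm_coords_le (a : A) (n : ℕ) : ‖SA.coords a n‖ ≤ ‖a‖ := by
  have h := norm_mul_le (SA.p n) a
  rwa [p_mul, norm_smul, SA.norm_p, mul_one, one_mul] at h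

lemma eventually_coords_eq_zero {b : A} (hb : b ∈ Submodule.span ℂ (Set.range SA.p)) :
    ∀ᶠ n in atTop, SA.coords b n = 0 := by
  induction hb using Submodule.span_induction with
  | mem x hx =>
    obtain ⟨k, rfl⟩ := hx
    filter_upwards [eventually_gt_atTop k] with n hn
    simp [SA.coords_p, hn.ne']
  | zero => simp
  | add x y _ _ hx hy =>
    filter_upwards [hx, hy] with n h1 h2
    simp [h1, h2]
  | smul c x _ hx =>
    filter_upwards [hx] with n h
    simp [h]

lemma tendsto_coords (a : A) : Tendsto (SA.coords a) atTop (𝓝 0) := by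
  rw [Metric.tendsto_nhds]
  intro ε hε
  obtain ⟨b, hb, hab⟩ := Metric.mem_closure_iff.1 (SA.dense_c00 a) ε hε
  filter_upwards [SA.eventually_coords_eq_zero hb] with n hn
  have h := SA.norm_coords_le (a - b) n
  rw [map_sub, Pi.sub_apply, hn, sub_zero] at h
  rw [dist_zero_right]
  exact h.trans_lt (by rwa [← dist_eq_norm])

end SequenceAlgebra

namespace NormedMod

omit [IsScalarTower ℂ A A] [SMulCommClass ℂ A A]


variable (M N : NormedMod A)

lemma smulLM_apply (a : A) (x : M.X) : M.smulLM a x = M.smul a x := rfl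

lemma smul_zero (a : A) : M.smul a 0 = 0 := (M.smulLM a).map_zero

lemma smul_sub (a : A) (x y : M.X) : M.smul a (x - y) = M.smul a x - M.smul a y :=
  (M.smulLM a).map_sub x y

lemma p_smul_smul (n : ℕ) (a : A) (x : M.X) :
    M.smul (SA.p n) (M.smul a x) = SA.coords a n • M.smul (SA.p n) x := by
  rw [← M.mul_smul, SA.p_mul, M.csmul_smul]

lemma smul_p_smul (n : ℕ) (a : A) (x : M.X) :
    M.smul a (M.smul (SA.p n) x) = SA.coords a n • M.smul (SA.p n) x := by
  rw [← M.mul_smul, SA.mul_p, M.csmul_smul]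

lemma p_smul_p_smul (m n : ℕ) (x : M.X) :
    M.smul (SA.p m) (M.smul (SA.p n) x) = if m = n then M.smul (SA.p n) x else 0 := by
  rw [smul_p_smul, SA.coords_p]
  by_cases h : m = n <;> simp [h, eq_comm]

lemma norm_p_smul_le (n : ℕ) (x : M.X) : ‖M.smul (SA.p n) x‖ ≤ ‖x‖ := by
  simpa [SA.norm_p] using M.norm_smul_le (SA.p n) x

variable {M N}

lemma p_smul_of_mem {n : ℕ} {x : M.X} (hx : x ∈ coordSub SA M n) : M.smul (SA.p n) x = x := by
  obtain ⟨y, rfl⟩ := hx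
  simp [smulLM_apply, p_smul_p_smul]

lemma p_smul_of_mem_ne {m n : ℕ} {x : M.X} (hx : x ∈ coordSub SA M n) (h : m ≠ n) :
    M.smul (SA.p m) x = 0 := by
  obtain ⟨y, rfl⟩ := hx
  simp [smulLM_apply, p_smul_p_smul, h]

lemma p_smul_mem (n : ℕ) (x : M.X) : M.smul (SA.p n) x ∈ coordSub SA M n := ⟨x, rfl⟩

lemma eq_of_p_smul_eq (hM : Homogeneous SA M) {x y : M.X}
    (h : ∀ n, M.smul (SA.p n) x = M.smul (SA.p n) y) : x = y := by
  rw [← sub_eq_zero, ← norm_le_zero_iff, ← norm_zero (E := M.X)]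
  apply hM
  intro n
  rw [smul_sub, h, sub_self, smul_zero]

lemma exists_p_smul_eq (v : ∀ n, coordSub SA M n) (hv : ∃ K, ∀ n, K ≤ n → v n = 0) :
    ∃ y : M.X, ∀ n, M.smul (SA.p n) y = v n := by
  obtain ⟨K, hK⟩ := hv
  refine ⟨∑ k ∈ Finset.range K, (v k : M.X), fun n => ?_⟩
  rw [← smulLM_apply, map_sum]
  by_cases hn : n < K
  · rw [Finset.sum_eq_single n]
    · exact p_smul_of_mem SA (v n).2
    · intro k _ hk
      exact p_smul_of_mem_ne SA (v k).2 hk.symm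
    · simp [hn]
  · rw [hK n (not_lt.1 hn), Submodule.coe_zero]
    refine Finset.sum_eq_zero fun k hk => p_smul_of_mem_ne SA (v k).2 ?_
    rintro rfl
    exact hn (Finset.mem_range.1 hk)

lemma tendsto_p_smul (hM : M.Essential) (x : M.X) :
    Tendsto (fun n => M.smul (SA.p n) x) atTop (𝓝 0) := by
  have key : ∀ y ∈ Submodule.span ℂ {y : M.X | ∃ (a : A) (x : M.X), y = M.smul a x},
      Tendsto (fun n => M.smul (SA.p n) y) atTop (𝓝 0) := by
    intro y hy
    induction hy using Submodule.span_induction with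
    | mem y hy =>
      obtain ⟨a, x, rfl⟩ := hy
      simp only [p_smul_smul]
      have h := (SA.tendsto_coords a).norm.mul_const ‖x‖
      rw [norm_zero, zero_mul] at h
      refine squeeze_zero_norm (fun n => ?_) h
      rw [norm_smul]
      gcongr
      exact M.norm_p_smul_le SA n x
    | zero => simp [smul_zero]
    | add x y _ _ hx hy => simpa [M.smul_add] using hx.add hy
    | smul c x _ hx => simpa [M.smul_csmul] using hx.const_smul c
  rw [Metric.tendsto_nhds]
  intro ε hε
  obtain ⟨y, hy, hxy⟩ := Metric.mem_closure_iff.1 (hM x) (ε / 2) (half_pos hε)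
  filter_upwards [Metric.tendsto_nhds.1 (key y hy) (ε / 2) (half_pos hε)] with n hn
  rw [dist_zero_right] at hn ⊢
  have h := M.norm_p_smul_le SA n (x - y)
  rw [smul_sub, ← dist_eq_norm x] at h
  have h' := norm_sub_norm_le (M.smul (SA.p n) x) (M.smul (SA.p n) y)
  linarith

variable (M) in
/-- The projection of a module onto its `n`-th coordinate subspace. -/
def coordProj (n : ℕ) : M.X →L[ℂ] coordSub SA M n :=
  ((M.smulLM (SA.p n)).rangeRestrict).mkContinuous 1 fun x => by
    rw [one_mul]
    exact M.norm_p_smul_le SA n x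

@[simp]
lemma coe_coordProj (n : ℕ) (x : M.X) : (M.coordProj SA n x : M.X) = M.smul (SA.p n) x := rfl

lemma norm_coordProj_le (n : ℕ) : ‖M.coordProj SA n‖ ≤ 1 :=
  LinearMap.mkContinuous_norm_le _ zero_le_one _

/-- The operator between `n`-th coordinate subspaces induced by a morphism. -/
def coordMap {f : M.X →L[ℂ] N.X} (hf : IsMor M N f) (n : ℕ) :
    coordSub SA M n →L[ℂ] coordSub SA N n :=
  (f.comp (coordSub SA M n).subtypeL).codRestrict (coordSub SA N n) fun x => by
    have h : f (x : M.X) = N.smul (SA.p n) (f x) := by rw [← hf, p_smul_of_mem SA x.2]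
    exact h ▸ p_smul_mem SA n _

@[simp]
lemma coe_coordMap {f : M.X →L[ℂ] N.X} (hf : IsMor M N f) (n : ℕ) (x : coordSub SA M n) :
    (coordMap SA hf n x : N.X) = f x := rfl

lemma isCoisometry_coordMap {f : M.X →L[ℂ] N.X} (hf : IsMor M N f) (hc : IsCoisometry f)
    (n : ℕ) : IsCoisometry (coordMap SA hf n) := by
  refine ⟨fun y => hc.1 y, fun x ε hε => ?_⟩
  obtain ⟨y, hy, hlt⟩ := hc.2 x ε hε
  refine ⟨M.coordProj SA n y, ?_, (M.norm_p_smul_le SA n y).trans_lt hlt⟩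
  ext
  rw [coe_coordMap, coe_coordProj, hf, hy, p_smul_of_mem SA x.2]

/-- A normed space placed at the `n`-th coordinate. -/
def point (n : ℕ) (E : Type) [NormedAddCommGroup E] [NormedSpace ℂ E] : NormedMod A where
  X := E
  smul a x := SA.coords a n • x
  smul_add a x y := _root_.smul_add _ _ _
  add_smul a b x := by rw [map_add, Pi.add_apply, _root_.add_smul]
  smul_csmul c a x := smul_comm _ _ _
  csmul_smul c a x := by rw [map_smul, Pi.smul_apply, smul_assoc]
  mul_smul a b x := by rw [SA.coords_mul, Pi.mul_apply, SemigroupAction.mul_smul]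
  norm_smul_le a x := by
    rw [norm_smul]
    gcongr
    exact SA.norm_coords_le a n

section point

variable (n : ℕ) (E : Type) [NormedAddCommGroup E] [NormedSpace ℂ E]

lemma essential_point : (point SA n E).Essential := by
  intro x
  refine subset_closure (Submodule.subset_span ⟨SA.p n, x, ?_⟩)
  change x = SA.coords (SA.p n) n • x
  simp [SA.coords_p]

lemma homogeneous_point : Homogeneous SA (point SA n E) := by
  intro x y h
  have h1 : ‖SA.coords (SA.p n) n • x‖ ≤ ‖SA.coords (SA.p n) n • y‖ := h n
  simpa [SA.coords_p] using h1

end point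

end NormedMod

section Projectivity

omit [IsScalarTower ℂ A A] [SMulCommClass ℂ A A]

variable {SA} {X : NormedMod A}

lemma ContinuousLinearMap.exists_norm_le_mul_norm_apply {E F : Type*} [NormedAddCommGroup E]
    [NormedSpace ℂ E] [NormedAddCommGroup F] [NormedSpace ℂ F] (f : E →L[ℂ] F) {r c : ℝ}
    (hr : 0 ≤ r) (hc : 1 < c) : ∃ u : E, ‖u‖ ≤ r ∧ ‖f‖ * r ≤ c * ‖f u‖ := by
  rcases (norm_nonneg f).eq_or_lt with h | h
  · exact ⟨0, by simpa using hr, by simp [← h]⟩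
  · obtain ⟨v, hv, hfv⟩ := f.exists_lt_apply_of_lt_opNorm (div_lt_self h hc)
    rw [div_lt_iff₀ (by linarith)] at hfv
    refine ⟨(r : ℂ) • v, ?_, ?_⟩
    · rw [norm_smul, Complex.norm_real, Real.norm_of_nonneg hr]
      exact mul_le_of_le_one_right hr hv.le
    · rw [map_smul, norm_smul, Complex.norm_real, Real.norm_of_nonneg hr]
      nlinarith

lemma ExtremelyProjectiveNor.exists_lift {P Y Z : Type} [NormedAddCommGroup P] [NormedSpace ℂ P]
    [NormedAddCommGroup Y] [NormedSpace ℂ Y] [NormedAddCommGroup Z] [NormedSpace ℂ Z]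
    (hP : ExtremelyProjectiveNor P) {τ : Y →L[ℂ] Z} (hτ : IsCoisometry τ) (φ : P →L[ℂ] Z)
    {c : ℝ} (hc : 1 < c) : ∃ ψ : P →L[ℂ] Y, τ.comp ψ = φ ∧ ‖ψ‖ ≤ c * ‖φ‖ := by
  rcases (norm_nonneg φ).eq_or_lt with h | h
  · rw [eq_comm, norm_eq_zero] at h
    exact ⟨0, by simp [h], by simp [h]⟩
  · obtain ⟨ψ, h1, h2⟩ := hP Y Z τ hτ φ ((c - 1) * ‖φ‖) (mul_pos (by linarith) h)
    exact ⟨ψ, h1, by linarith⟩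

open NormedMod

theorem ExtremelyProjective.coordSub
    (hX : ExtremelyProjective X (fun M => M.Essential ∧ Homogeneous SA M)) (n : ℕ) :
    ExtremelyProjectiveNor ↥(coordSub SA X n) := by
  intro Y Z _ _ _ _ τ hτ φ ε hε
  obtain ⟨ψ, -, h2, h3⟩ := hX (point SA n Y) (point SA n Z)
    ⟨essential_point SA n Y, homogeneous_point SA n Y⟩
    ⟨essential_point SA n Z, homogeneous_point SA n Z⟩ τ (fun a x => τ.map_smul _ x) hτ
    (φ.comp (X.coordProj SA n))
    (fun a x => by
      change φ _ = SA.coords a n • φ _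
      rw [← map_smul]
      congr 1
      ext
      exact X.p_smul_smul SA n a x) ε hε
  have hproj : ∀ u : ↥(_root_.coordSub SA X n), X.coordProj SA n u = u := fun u =>
    Subtype.ext (p_smul_of_mem SA u.2)
  refine ⟨ContinuousLinearMap.comp (M₂ := X.X) ψ (_root_.coordSub SA X n).subtypeL, ?_, ?_⟩
  · ext u
    have h := DFunLike.congr_fun h2 (u : X.X)
    refine h.trans ?_
    change φ (X.coordProj SA n u) = φ u
    rw [hproj]
  · have h4 : ‖φ.comp (X.coordProj SA n)‖ ≤ ‖φ‖ :=
      (ContinuousLinearMap.opNorm_comp_le _ _).trans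
        (mul_le_of_le_one_right (norm_nonneg _) (norm_coordProj_le SA n))
    have h5 : ‖ContinuousLinearMap.comp (M₂ := X.X) ψ (_root_.coordSub SA X n).subtypeL‖ ≤ ‖ψ‖ :=
      (ContinuousLinearMap.opNorm_comp_le _ _).trans
        (mul_le_of_le_one_right (norm_nonneg _) (Submodule.norm_subtypeL_le _))
    exact (h5.trans_lt h3).trans_le (add_le_add h4 le_rfl)

/-- Lifts of a morphism on all coordinate subspaces, each almost norm-preserving, assemble to an
almost norm-preserving map, since the norm of `X` only sees the norms of the coordinates. -/
lemma norm_le_of_coord_lifts (hhom : Homogeneous SA X) (hfin : FiniteType SA X)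
    {MY MX : NormedMod A} (hY : Homogeneous SA MY) {τ : MY.X →L[ℂ] MX.X} (hτ : IsMor MY MX τ)
    (hcoi : IsCoisometry τ) {φ : X.X →L[ℂ] MX.X} (hφ : IsMor X MX φ) {c : ℝ} (hc : 1 < c)
    {x : X.X} {y : MY.X}
    (hy : ∀ n, ‖MY.smul (SA.p n) y‖ ≤ c * ‖coordMap SA hφ n‖ * ‖X.smul (SA.p n) x‖) :
    ‖y‖ ≤ c * c * ‖φ‖ * ‖x‖ := by
  have hc0 : 0 < c * c := by positivity
  choose u hux hu using fun n =>
    (coordMap SA hφ n).exists_norm_le_mul_norm_apply (norm_nonneg (X.smul (SA.p n) x)) hc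
  obtain ⟨K, hK⟩ := hfin x
  obtain ⟨w, hw⟩ := exists_p_smul_eq SA u ⟨K, fun n hn => by
    simpa [hK n hn] using hux n⟩
  have hwx : ‖w‖ ≤ ‖x‖ := hhom w x fun n => by
    rw [hw]
    exact hux n
  refine le_of_forall_pos_le_add fun δ hδ => ?_
  obtain ⟨z, hz, hzlt⟩ := hcoi.2 (φ w) (δ / (c * c)) (by positivity)
  have hle : ‖y‖ ≤ ‖((c * c : ℝ) : ℂ) • z‖ := by
    refine hY _ _ fun n => (hy n).trans ?_
    rw [MY.smul_csmul, norm_smul, Complex.norm_real, Real.norm_of_nonneg hc0.le, mul_assoc,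
      mul_assoc]
    have h1 : ‖coordMap SA hφ n (u n)‖ ≤ ‖MY.smul (SA.p n) z‖ := by
      refine le_trans (le_of_eq ?_) (hcoi.1 _)
      rw [hτ, hz, ← hφ, hw]
      rfl
    exact mul_le_mul_of_nonneg_left ((hu n).trans (by gcongr)) (by linarith)
  calc ‖y‖ ≤ c * c * ‖z‖ := by
        rwa [norm_smul, Complex.norm_real, Real.norm_of_nonneg hc0.le] at hle
    _ ≤ c * c * (‖φ‖ * ‖x‖ + δ / (c * c)) := by
        gcongr
        refine hzlt.le.trans ?_
        gcongr
        exact (φ.le_opNorm w).trans (by gcongr)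
    _ = c * c * ‖φ‖ * ‖x‖ + δ := by
        field_simp

theorem extremelyProjective_of_coordSub (hhom : Homogeneous SA X)
    (hX : ∀ n, ExtremelyProjectiveNor ↥(coordSub SA X n)) (hfin : FiniteType SA X) :
    ExtremelyProjective X (fun M => M.Essential ∧ Homogeneous SA M) := by
  intro MY MX hMY hMX τ hτ hcoi φ hφ ε hε
  obtain ⟨c, hc, hcε⟩ : ∃ c : ℝ, 1 < c ∧ c * c * ‖φ‖ < ‖φ‖ + ε := by
    have h : Tendsto (fun c : ℝ => c * c * ‖φ‖) (𝓝[>] 1) (𝓝 (1 * 1 * ‖φ‖)) :=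
      (Continuous.tendsto (by fun_prop) 1).mono_left nhdsWithin_le_nhds
    obtain ⟨c, h1, h2⟩ := ((h.eventually_lt_const (by linarith : 1 * 1 * ‖φ‖ < ‖φ‖ + ε)).and
      self_mem_nhdsWithin).exists
    exact ⟨c, h2, h1⟩
  choose ψ hψ hψn using fun n => (hX n).exists_lift (isCoisometry_coordMap SA hτ hcoi n)
    (coordMap SA hφ n) hc
  choose Ψ hΨ using fun x : X.X => exists_p_smul_eq SA (fun n => ψ n (X.coordProj SA n x)) (by
    obtain ⟨K, hK⟩ := hfin x
    refine ⟨K, fun n hn => ?_⟩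
    rw [show X.coordProj SA n x = 0 from Subtype.ext (hK n hn), map_zero])
  let L : X.X →ₗ[ℂ] MY.X :=
    { toFun := Ψ
      map_add' := fun x y => eq_of_p_smul_eq SA hMY.2 fun n => by
        simp [MY.smul_add, hΨ]
      map_smul' := fun k x => eq_of_p_smul_eq SA hMY.2 fun n => by
        simp [MY.smul_csmul, hΨ] }
  have hL : ∀ x, ‖L x‖ ≤ c * c * ‖φ‖ * ‖x‖ := fun x => by
    refine norm_le_of_coord_lifts hhom hfin hMY.2 hτ hcoi hφ hc fun n => ?_
    change ‖MY.smul (SA.p n) (Ψ x)‖ ≤ _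
    rw [hΨ]
    exact ((ψ n).le_opNorm _).trans (by gcongr; exacts [hψn n, le_rfl])
  refine ⟨L.mkContinuous _ hL, fun a x => ?_, ?_,
    (L.mkContinuous_norm_le (by positivity) hL).trans_lt hcε⟩
  · refine eq_of_p_smul_eq SA hMY.2 fun n => ?_
    change MY.smul (SA.p n) (Ψ _) = MY.smul (SA.p n) (MY.smul a (Ψ x))
    rw [p_smul_smul, hΨ, hΨ, ← Submodule.coe_smul, ← map_smul]
    congr 2
    exact Subtype.ext (X.p_smul_smul SA n a x)
  · ext x
    refine eq_of_p_smul_eq SA hMX.2 fun n => ?_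
    change MX.smul (SA.p n) (τ (Ψ x)) = _
    rw [← hτ, hΨ, ← hφ]
    exact congrArg Subtype.val (DFunLike.congr_fun (hψ n) (X.coordProj SA n x))

end Projectivity

section VanishingSequences

open scoped BoundedContinuousFunction

omit [IsScalarTower ℂ A A] [SMulCommClass ℂ A A]

lemma BoundedContinuousFunction.norm_ofNormedAddCommGroupDiscrete_le {α β : Type*}
    [TopologicalSpace α] [DiscreteTopology α] [SeminormedAddCommGroup β] {f : α → β} {C : ℝ}
    (hC : 0 ≤ C) (H : ∀ x, ‖f x‖ ≤ C) : ‖ofNormedAddCommGroupDiscrete f C H‖ ≤ C :=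
  (norm_le hC).2 H

namespace SequenceAlgebra

variable (E : Type) [NormedAddCommGroup E] [NormedSpace ℂ E]

/-- A space of sequences in `E` tending to zero, stable under coordinatewise multiplication by
elements of a sequence algebra. -/
structure NullSpace where
  carrier : Submodule ℂ (ℕ →ᵇ E)
  tendsto_zero : ∀ y ∈ carrier, Tendsto y atTop (𝓝 0)
  mul_mem : ∀ (a : A), ∀ y ∈ carrier, ∀ z : ℕ →ᵇ E,
    (∀ n, z n = SA.coords a n • y n) → z ∈ carrier

variable {SA E}

/-- Coordinatewise multiplication of a bounded sequence in `E` by an element of a sequence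
algebra. -/
def mulSeq (SA : SequenceAlgebra A) (a : A) (y : ℕ →ᵇ E) : ℕ →ᵇ E :=
  BoundedContinuousFunction.ofNormedAddCommGroupDiscrete (fun n => SA.coords a n • y n)
    (‖a‖ * ‖y‖) fun n => by
      rw [norm_smul]
      gcongr
      exacts [SA.norm_coords_le a n, y.norm_coe_le_norm n]

@[simp]
lemma mulSeq_apply (a : A) (y : ℕ →ᵇ E) (n : ℕ) : SA.mulSeq a y n = SA.coords a n • y n := rfl

lemma norm_mulSeq_le (a : A) (y : ℕ →ᵇ E) : ‖SA.mulSeq a y‖ ≤ ‖a‖ * ‖y‖ :=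
  BoundedContinuousFunction.norm_ofNormedAddCommGroupDiscrete_le (by positivity) _

lemma norm_mulSeq_p (n : ℕ) (y : ℕ →ᵇ E) : ‖SA.mulSeq (SA.p n) y‖ = ‖y n‖ := by
  apply le_antisymm
  · rw [BoundedContinuousFunction.norm_le (norm_nonneg _)]
    intro m
    by_cases h : m = n <;> simp [SA.coords_p, h]
  · simpa [SA.coords_p] using (SA.mulSeq (SA.p n) y).norm_coe_le_norm n

namespace NullSpace

variable (V : NullSpace SA E)

/-- A space of null sequences as a normed module. -/
def toNormedMod : NormedMod A where
  X := V.carrier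
  smul a y := ⟨SA.mulSeq a y, V.mul_mem a y y.2 _ fun _ => rfl⟩
  smul_add a x y := Subtype.ext <| BoundedContinuousFunction.ext fun n => by simp
  add_smul a b x := Subtype.ext <| BoundedContinuousFunction.ext fun n => by simp [add_smul]
  smul_csmul c a x := Subtype.ext <| BoundedContinuousFunction.ext fun n => by
    simp [smul_comm c]
  csmul_smul c a x := Subtype.ext <| BoundedContinuousFunction.ext fun n => by
    simp [SemigroupAction.mul_smul]
  mul_smul a b x := Subtype.ext <| BoundedContinuousFunction.ext fun n => by
    simp [SA.coords_mul, SemigroupAction.mul_smul]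
  norm_smul_le a x := norm_mulSeq_le a (x : ℕ →ᵇ E)

lemma homogeneous_toNormedMod : Homogeneous SA V.toNormedMod := by
  intro x y h
  change ‖(x.1 : ℕ →ᵇ E)‖ ≤ ‖(y.1 : ℕ →ᵇ E)‖
  rw [BoundedContinuousFunction.norm_le (norm_nonneg _)]
  intro n
  have hn : ‖SA.mulSeq (SA.p n) x.1‖ ≤ ‖SA.mulSeq (SA.p n) y.1‖ := h n
  rw [norm_mulSeq_p, norm_mulSeq_p] at hn
  exact hn.trans (y.1.norm_coe_le_norm n)

lemma essential_toNormedMod : V.toNormedMod.Essential := by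
  intro x
  change V.carrier at x
  refine Metric.mem_closure_iff.2 fun ε hε => ?_
  obtain ⟨K, hK⟩ := eventually_atTop.1
    (Metric.tendsto_nhds.1 (V.tendsto_zero x x.2) (ε / 2) (half_pos hε))
  refine ⟨V.toNormedMod.smul (∑ k ∈ Finset.range K, SA.p k) x,
    Submodule.subset_span ⟨_, _, rfl⟩, ?_⟩
  refine lt_of_le_of_lt (b := ε / 2) ?_ (half_lt_self hε)
  change dist (x : ℕ →ᵇ E) (SA.mulSeq _ x) ≤ ε / 2
  rw [BoundedContinuousFunction.dist_le (half_pos hε).le]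
  intro n
  by_cases hn : n < K
  · simp [map_sum, SA.coords_p, hn, (half_pos hε).le]
  · simpa [map_sum, SA.coords_p, hn] using (hK n (not_lt.1 hn)).le

end NullSpace

variable (SA E) in
/-- The space of all null sequences. -/
def nullSeq : NullSpace SA E where
  carrier :=
    { carrier := {y | Tendsto y atTop (𝓝 0)}
      zero_mem' := tendsto_const_nhds
      add_mem' := fun hx hy => add_zero (0 : E) ▸ Tendsto.add hx hy
      smul_mem' := fun c _ hx => smul_zero (A := E) c ▸ Tendsto.const_smul hx c }
  tendsto_zero y hy := hy
  mul_mem a y hy z hz := by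
    have h : Tendsto y atTop (𝓝 0) := hy
    have h' := (SA.tendsto_coords a).smul h
    rw [zero_smul] at h'
    exact h'.congr fun n => (hz n).symm

variable (SA) in
/-- The operator into null sequences whose coordinates are given contractive linear maps. -/
def toNullSeq {X : Type} [NormedAddCommGroup X] [NormedSpace ℂ X] (f : ℕ → X →ₗ[ℂ] E)
    (hf : ∀ n x, ‖f n x‖ ≤ ‖x‖) (h0 : ∀ x, Tendsto (fun n => f n x) atTop (𝓝 0)) :
    X →L[ℂ] (SA.nullSeq E).toNormedMod.X :=
  LinearMap.mkContinuous (𝕜 := ℂ) (F := (SA.nullSeq E).carrier)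
    { toFun := fun x => ⟨BoundedContinuousFunction.ofNormedAddCommGroupDiscrete
        (fun n => f n x) ‖x‖ fun n => hf n x, h0 x⟩
      map_add' := fun x y => Subtype.ext <| BoundedContinuousFunction.ext fun n =>
        (f n).map_add x y
      map_smul' := fun c x => Subtype.ext <| BoundedContinuousFunction.ext fun n =>
        (f n).map_smul c x } 1
    fun x => (BoundedContinuousFunction.norm_ofNormedAddCommGroupDiscrete_le
      (norm_nonneg x) fun n => hf n x).trans_eq (one_mul _).symm

lemma norm_toNullSeq_apply_le {X : Type} [NormedAddCommGroup X] [NormedSpace ℂ X]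
    (f : ℕ → X →ₗ[ℂ] E) (hf : ∀ n x, ‖f n x‖ ≤ ‖x‖)
    (h0 : ∀ x, Tendsto (fun n => f n x) atTop (𝓝 0)) (x : X) :
    ‖SA.toNullSeq f hf h0 x‖ ≤ ‖x‖ :=
  BoundedContinuousFunction.norm_ofNormedAddCommGroupDiscrete_le (norm_nonneg x) fun n => hf n x

end SequenceAlgebra

/-- Null sequences of scalars of modulus at most one. -/
structure NullWeight where
  toFun : ℕ → ℂ
  norm_le_one : ∀ n, ‖toFun n‖ ≤ 1
  tendsto_zero : Tendsto toFun atTop (𝓝 0)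

namespace NullWeight

instance : TopologicalSpace NullWeight := ⊥

instance : DiscreteTopology NullWeight := ⟨rfl⟩

/-- Evaluation of weights at `n`. -/
def eval (n : ℕ) : NullWeight →ᵇ ℂ :=
  BoundedContinuousFunction.ofNormedAddCommGroupDiscrete (fun μ => μ.toFun n) 1
    fun μ => μ.norm_le_one n

@[simp]
lemma eval_apply (n : ℕ) (μ : NullWeight) : eval n μ = μ.toFun n := rfl

lemma norm_eval_le (n : ℕ) : ‖eval n‖ ≤ 1 :=
  BoundedContinuousFunction.norm_ofNormedAddCommGroupDiscrete_le zero_le_one _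

/-- Functionals that only depend on the restriction of a function to `S`. -/
def supportedOn (S : Set NullWeight) : Submodule ℂ (StrongDual ℂ (NullWeight →ᵇ ℂ)) where
  carrier := {ν | ∀ f : NullWeight →ᵇ ℂ, (∀ μ ∈ S, f μ = 0) → ν f = 0}
  zero_mem' _ _ := rfl
  add_mem' h h' f hf := by simp [h f hf, h' f hf]
  smul_mem' c _ h f hf := by simp [h f hf]

lemma supportedOn_mono {S T : Set NullWeight} (h : S ⊆ T) : supportedOn S ≤ supportedOn T :=
  fun _ hν f hf => hν f fun μ hμ => hf μ (h hμ)

lemma norm_apply_le_of_mem_supportedOn {S : Set NullWeight}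
    {ν : StrongDual ℂ (NullWeight →ᵇ ℂ)} (hν : ν ∈ supportedOn S) (f : NullWeight →ᵇ ℂ) {δ : ℝ}
    (hδ : 0 ≤ δ) (hf : ∀ μ ∈ S, ‖f μ‖ ≤ δ) : ‖ν f‖ ≤ ‖ν‖ * δ := by
  classical
  have hb : ∀ μ, ‖S.indicator f μ‖ ≤ δ := fun μ => by
    by_cases h : μ ∈ S <;> simp [h, hδ, hf]
  let g : NullWeight →ᵇ ℂ :=
    BoundedContinuousFunction.ofNormedAddCommGroupDiscrete (S.indicator f) δ hb
  have hg : ν f = ν g := by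
    rw [← sub_eq_zero, ← map_sub]
    exact hν _ fun μ hμ => by simp [g, hμ]
  rw [hg]
  exact ν.le_opNorm_of_le (BoundedContinuousFunction.norm_ofNormedAddCommGroupDiscrete_le hδ hb)

lemma eventually_norm_eval_le (S : Finset NullWeight) {δ : ℝ} (hδ : 0 < δ) :
    ∀ᶠ n in atTop, ∀ ν ∈ supportedOn (S : Set NullWeight), ‖ν (eval n)‖ ≤ ‖ν‖ * δ := by
  have h : ∀ᶠ n in atTop, ∀ μ ∈ S, ‖μ.toFun n‖ ≤ δ := by
    rw [Filter.eventually_all_finset]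
    intro μ _
    have h' := μ.tendsto_zero.norm
    rw [norm_zero] at h'
    exact h'.eventually_le_const hδ
  filter_upwards [h] with n hn ν hν
  exact norm_apply_le_of_mem_supportedOn hν _ hδ.le hn

/-- Every scalar null sequence is the product of a null weight and a null sequence of almost the
same norm. -/
lemma exists_factorization (x : ℕ →ᵇ ℂ) (hx : Tendsto x atTop (𝓝 0)) {δ : ℝ} (hδ : 0 < δ) :
    ∃ (μ : NullWeight) (g : ℕ → ℂ), (∀ n, μ.toFun n * g n = x n) ∧
      (∀ n, ‖g n‖ ≤ max ‖x‖ δ) ∧ Tendsto g atTop (𝓝 0) := by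
  have hx' : Tendsto (fun n => ‖x n‖) atTop (𝓝 0) := by simpa using hx.norm
  let w : ℕ → ℝ := fun n => min 1 √(‖x n‖ / δ)
  have hw : ∀ n, 0 ≤ w n := fun n => by positivity
  have hw0 : Tendsto w atTop (𝓝 0) := by
    have h : Tendsto w atTop (𝓝 (min 1 √(0 / δ))) :=
      tendsto_const_nhds.min ((hx'.div_const δ).sqrt)
    simpa using h
  have hg : ∀ n, ‖x n / (w n : ℂ)‖ ≤ max ‖x n‖ √(‖x n‖ * δ) := by
    intro n
    rw [norm_div, Complex.norm_real, Real.norm_of_nonneg (hw n)]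
    rcases le_total 1 √(‖x n‖ / δ) with h | h
    · exact le_max_of_le_left (by rw [show w n = 1 from min_eq_left h, div_one])
    · refine le_max_of_le_right ?_
      rw [show w n = √(‖x n‖ / δ) from min_eq_right h]
      rcases (norm_nonneg (x n)).eq_or_lt with h0 | h0
      · simp [← h0]
      · rw [div_le_iff₀ (by positivity), ← Real.sqrt_mul (by positivity)]
        apply Real.le_sqrt_of_sq_le
        apply le_of_eq
        field_simp
  refine ⟨⟨fun n => w n, fun n => ?_, ?_⟩, fun n => x n / w n, fun n => ?_, fun n => ?_, ?_⟩
  · rw [Complex.norm_real, Real.norm_of_nonneg (hw n)]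
    exact min_le_left _ _
  · exact Complex.ofReal_zero ▸ (Complex.continuous_ofReal.tendsto 0).comp hw0
  · rcases eq_or_ne (x n) 0 with h | h
    · simp [h]
    · refine mul_div_cancel₀ _ ?_
      have : 0 < w n := by
        have := norm_pos_iff.2 h
        positivity
      exact Complex.ofReal_ne_zero.2 this.ne'
  · refine (hg n).trans (max_le (le_max_of_le_left (x.norm_coe_le_norm n)) ?_)
    rw [Real.sqrt_le_left (by positivity), sq]
    gcongr
    exacts [le_max_of_le_left (x.norm_coe_le_norm n), le_max_right _ _]
  · refine squeeze_zero_norm hg ?_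
    have h : Tendsto (fun n => max ‖x n‖ √(‖x n‖ * δ)) atTop (𝓝 (max 0 √(0 * δ))) :=
      hx'.max (hx'.mul_const δ).sqrt
    simpa using h

/-- Null sequences of functionals on functions of weights, jointly supported on a finite set. -/
def finSupp : SequenceAlgebra.NullSpace SA (StrongDual ℂ (NullWeight →ᵇ ℂ)) where
  carrier :=
    { carrier := {y | Tendsto y atTop (𝓝 0) ∧
        ∃ S : Finset NullWeight, ∀ n, y n ∈ supportedOn (S : Set NullWeight)}
      zero_mem' := ⟨tendsto_const_nhds, ∅, fun _ => zero_mem _⟩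
      add_mem' := by
        classical
        rintro x y ⟨hx, S, hS⟩ ⟨hy, T, hT⟩
        refine ⟨(SA.nullSeq (StrongDual ℂ (NullWeight →ᵇ ℂ))).carrier.add_mem hx hy, S ∪ T,
          fun n => add_mem ?_ ?_⟩
        · exact supportedOn_mono (by simp) (hS n)
        · exact supportedOn_mono (by simp) (hT n)
      smul_mem' := by
        rintro c x ⟨hx, S, hS⟩
        exact ⟨(SA.nullSeq (StrongDual ℂ (NullWeight →ᵇ ℂ))).carrier.smul_mem c hx, S,
          fun n => Submodule.smul_mem _ _ (hS n)⟩ }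
  tendsto_zero y hy := hy.1
  mul_mem a y hy z hz := by
    obtain ⟨hy, S, hS⟩ := hy
    exact ⟨(SA.nullSeq _).mul_mem a y hy z hz, S,
      fun n => hz n ▸ Submodule.smul_mem _ _ (hS n)⟩

/-- The multiplication map from finitely supported null sequences of functionals to scalar null
sequences, pairing the `n`-th functional with the evaluation of weights at `n`. -/
def pairing : (finSupp SA).toNormedMod.X →L[ℂ] (SA.nullSeq ℂ).toNormedMod.X :=
  SA.toNullSeq (X := (finSupp SA).carrier)
    (fun n =>
      { toFun := fun y => y.1 n (eval n)
        map_add' := fun _ _ => rfl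
        map_smul' := fun _ _ => rfl })
    (fun n y => ((y.1 n).le_of_opNorm_le_of_le (y.1.norm_coe_le_norm n) (norm_eval_le n)).trans_eq
      (mul_one _))
    (fun y => squeeze_zero_norm
      (fun n => ((y.1 n).le_opNorm_of_le (norm_eval_le n)).trans_eq (mul_one _))
      (by simpa using ((finSupp SA).tendsto_zero y.1 y.2).norm))

lemma isMor_pairing : IsMor (finSupp SA).toNormedMod (SA.nullSeq ℂ).toNormedMod (pairing SA) :=
  fun _ _ => Subtype.ext <| BoundedContinuousFunction.ext fun _ => rfl

lemma isCoisometry_pairing : IsCoisometry (pairing SA) := by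
  refine ⟨fun y => ?_, fun x ε hε => ?_⟩
  · exact SequenceAlgebra.norm_toNullSeq_apply_le _ _ _ y
  · change (SA.nullSeq ℂ).carrier at x
    obtain ⟨μ, g, h1, h2, h3⟩ := exists_factorization x.1 x.2 (half_pos hε)
    let e : StrongDual ℂ (NullWeight →ᵇ ℂ) := BoundedContinuousFunction.evalCLM ℂ μ
    have he : ‖e‖ ≤ 1 := ContinuousLinearMap.opNorm_le_bound _ zero_le_one fun f => by
      rw [one_mul]
      exact f.norm_coe_le_norm μ
    have hge : ∀ n, ‖g n • e‖ ≤ ‖g n‖ := fun n => by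
      rw [norm_smul]
      exact mul_le_of_le_one_right (norm_nonneg _) he
    let y : ℕ →ᵇ StrongDual ℂ (NullWeight →ᵇ ℂ) :=
      BoundedContinuousFunction.ofNormedAddCommGroupDiscrete (fun n => g n • e)
        (max ‖x.1‖ (ε / 2)) fun n => (hge n).trans (h2 n)
    have hy : y ∈ (finSupp SA).carrier := by
      refine ⟨?_, {μ}, fun n => Submodule.smul_mem _ _ fun f hf => hf μ (by simp)⟩
      exact zero_smul ℂ e ▸ h3.smul_const e
    refine ⟨⟨y, hy⟩, ?_, ?_⟩
    · refine Subtype.ext <| BoundedContinuousFunction.ext fun n => ?_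
      exact (mul_comm _ _).trans (h1 n)
    · have hle : ‖y‖ ≤ max ‖x.1‖ (ε / 2) :=
        BoundedContinuousFunction.norm_ofNormedAddCommGroupDiscrete_le (by positivity) _
      have h0 : 0 ≤ ‖x.1‖ := norm_nonneg _
      have hlt : ‖y‖ < ‖x.1‖ + ε :=
        hle.trans_lt (max_lt (lt_add_of_pos_right _ hε) (by linarith))
      exact hlt

end NullWeight

open NormedMod

theorem TopologicallyProjective.finiteType {X : NormedMod A} (hess : X.Essential)
    (hX : TopologicallyProjective X (fun M => M.Essential ∧ Homogeneous SA M)) :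
    FiniteType SA X := by
  intro x
  choose g hg hgx using fun n => exists_dual_vector'' ℂ (X.smul (SA.p n) x)
  have hb : ∀ n u, ‖g n (X.smul (SA.p n) u)‖ ≤ ‖X.smul (SA.p n) u‖ := fun n u => by
    simpa using (g n).le_of_opNorm_le (hg n) (X.smul (SA.p n) u)
  let φ : X.X →L[ℂ] (SA.nullSeq ℂ).toNormedMod.X :=
    SA.toNullSeq (fun n => (g n : X.X →ₗ[ℂ] ℂ).comp (X.smulLM (SA.p n)))
      (fun n u => (hb n u).trans (X.norm_p_smul_le SA n u))
      (fun u => squeeze_zero_norm (fun n => hb n u)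
        (by simpa using (tendsto_p_smul SA hess u).norm))
  have hφ : IsMor X (SA.nullSeq ℂ).toNormedMod φ := fun a u =>
    Subtype.ext <| BoundedContinuousFunction.ext fun n => by
      change g n (X.smul (SA.p n) (X.smul a u)) = SA.coords a n • g n (X.smul (SA.p n) u)
      rw [p_smul_smul, map_smul]
  obtain ⟨ψ, hψ, hτψ⟩ := hX _ _
    ⟨(NullWeight.finSupp SA).essential_toNormedMod,
      (NullWeight.finSupp SA).homogeneous_toNormedMod⟩
    ⟨(SA.nullSeq ℂ).essential_toNormedMod, (SA.nullSeq ℂ).homogeneous_toNormedMod⟩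
    (NullWeight.pairing SA) (NullWeight.isMor_pairing SA)
    (NullWeight.isCoisometry_pairing SA) φ hφ
  obtain ⟨y, hy⟩ : ∃ y : (NullWeight.finSupp SA).carrier, y = ψ x := ⟨_, rfl⟩
  obtain ⟨-, S, hS⟩ := y.2
  have hyn : ∀ n, ‖y.1 n‖ ≤ ‖ψ‖ * ‖X.smul (SA.p n) x‖ := fun n => by
    have h := ψ.le_opNorm (X.smul (SA.p n) x)
    rw [hψ, ← hy] at h
    exact (SequenceAlgebra.norm_mulSeq_p (SA := SA) n y.1).symm.trans_le h
  have hxn : ∀ n, ‖y.1 n (NullWeight.eval n)‖ = ‖X.smul (SA.p n) x‖ := fun n => by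
    have h : NullWeight.pairing SA y = φ x := by rw [hy]; exact DFunLike.congr_fun hτψ x
    have h' : y.1 n (NullWeight.eval n) = g n (X.smul (SA.p n) x) :=
      congrArg (fun z : (SA.nullSeq ℂ).carrier => z.1 n) h
    rw [h', hgx]
    simp
  have hpos : 0 < ‖ψ‖ + 1 := by positivity
  obtain ⟨K, hK⟩ := eventually_atTop.1
    (NullWeight.eventually_norm_eval_le S (inv_pos.2 hpos))
  refine ⟨K, fun n hn => ?_⟩
  have h := hK n hn _ (hS n)
  rw [hxn, ← div_eq_mul_inv, le_div_iff₀ hpos] at h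
  have := hyn n
  rw [← norm_le_zero_iff]
  linarith

end VanishingSequences

/-- Theorem I: an essential homogeneous normed module `X` over a sequence algebra is
extremely projective with respect to the class `H` of essential homogeneous normed
modules iff (i) every coordinate subspace `Xₙ` is extremely projective in Nor, and
(ii) `X` is of finite type; moreover topological projectivity with respect to `H`
already forces (ii). -/
theorem theoremI
    (X : NormedMod A) (hess : X.Essential) (hhom : Homogeneous SA X) :
    (ExtremelyProjective X (fun M => M.Essential ∧ Homogeneous SA M) ↔
      ((∀ n : ℕ, ExtremelyProjectiveNor ↥(coordSub SA X n)) ∧ FiniteType SA X)) ∧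
    (TopologicallyProjective X (fun M => M.Essential ∧ Homogeneous SA M) →
      FiniteType SA X) := by
  have htop : TopologicallyProjective X (fun M => M.Essential ∧ Homogeneous SA M) →
      FiniteType SA X := TopologicallyProjective.finiteType SA hess
  refine ⟨⟨fun h => ⟨h.coordSub, htop fun MY MX hY hX τ hτ hc φ hφ => ?_⟩,
    fun h => extremelyProjective_of_coordSub hhom h.1 h.2⟩, htop⟩
  obtain ⟨ψ, h1, h2, -⟩ := h MY MX hY hX τ hτ hc φ hφ 1 one_pos
  exact ⟨ψ, h1, h2⟩

end
end

section
/- Let A be a normed algebra, K a class of normed A-modules, Q a normed A-module extremely projective with respect to K, and P a near-retract of Q (i.e. there exists a contractive morphism σ : Q → P which for every δ > 0 has a bounded right-inverse morphism ρ : P → Q with σ∘ρ = id_P and ‖ρ‖ < 1 + δ). Then P is extremely projective with respect to K. -/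
noncomputable section

open Filter Topology

variable {A : Type} [NonUnitalNormedRing A] [NormedSpace ℂ A]
  [IsScalarTower ℂ A A] [SMulCommClass ℂ A A]

variable (SA : SequenceAlgebra A)

/-- Proposition 1.1: if `Q` is extremely projective with respect to a class `K` of normed
`A`-modules and `P` is a near-retract of `Q`, then `P` is extremely projective with
respect to `K`. -/
theorem nearRetract_extremelyProjective
    (K : NormedMod A → Prop) (Q P : NormedMod A)
    (hQ : ExtremelyProjective Q K)
    (σ : Q.X →L[ℂ] P.X) (hσmor : IsMor Q P σ) (hσcontr : ∀ y : Q.X, ‖σ y‖ ≤ ‖y‖)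
    (hσinv : ∀ δ : ℝ, 0 < δ → ∃ ρ : P.X →L[ℂ] Q.X, IsMor P Q ρ ∧
      σ.comp ρ = ContinuousLinearMap.id ℂ P.X ∧ ‖ρ‖ < 1 + δ) :
    ExtremelyProjective P K := by
  intro MY MX hMY hMX τ hτmor hτ φ hφmor ε hε
  have hc : 0 < ‖φ‖ + ε / 2 := by positivity
  obtain ⟨ψ, hψmor, hψ, hψnorm⟩ := hQ MY MX hMY hMX τ hτmor hτ (φ.comp σ)
    (fun a x => by simp [hσmor a x, hφmor a (σ x)]) (ε / 2) (half_pos hε)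
  obtain ⟨ρ, hρmor, hρ, hρnorm⟩ := hσinv (ε / 2 / (‖φ‖ + ε / 2)) (by positivity)
  have hσnorm : ‖σ‖ ≤ 1 :=
    σ.opNorm_le_bound zero_le_one fun y => by simpa using hσcontr y
  have hφσ : ‖φ.comp σ‖ ≤ ‖φ‖ :=
    (φ.opNorm_comp_le σ).trans (mul_le_of_le_one_right (norm_nonneg φ) hσnorm)
  refine ⟨ψ.comp ρ, fun a x => by simp [hρmor a x, hψmor a (ρ x)], ?_, ?_⟩
  · rw [← ContinuousLinearMap.comp_assoc, hψ, ContinuousLinearMap.comp_assoc, hρ,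
      ContinuousLinearMap.comp_id]
  · calc ‖ψ.comp ρ‖ ≤ ‖ψ‖ * ‖ρ‖ := ψ.opNorm_comp_le ρ
      _ ≤ (‖φ‖ + ε / 2) * ‖ρ‖ := by gcongr; linarith
      _ < (‖φ‖ + ε / 2) * (1 + ε / 2 / (‖φ‖ + ε / 2)) := by gcongr
      _ = ‖φ‖ + ε := by field_simp; ring

end
end

section
/- Let A be a normed algebra and K a class of normed A-modules such that the completion of every module in K again belongs to K. If a normed A-module P is extremely projective with respect to K, then its completion P̄ is extremely projective with respect to the class K̄ of Banach A-modules that arise as completions of modules from K. -/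
noncomputable section

open Filter Topology

variable {A : Type} [NonUnitalNormedRing A] [NormedSpace ℂ A]
  [IsScalarTower ℂ A A] [SMulCommClass ℂ A A]

variable (SA : SequenceAlgebra A)

/-- `N` is a completion of `M`: `N` is a Banach `A`-module in which `M` embeds by an
isometric module morphism with dense range. -/
def IsCompletionOf (M N : NormedMod A) : Prop :=
  CompleteSpace N.X ∧
    ∃ ι : M.X →L[ℂ] N.X, IsMor M N ι ∧ (∀ x : M.X, ‖ι x‖ = ‖x‖) ∧ DenseRange ι

omit [IsScalarTower ℂ A A] [SMulCommClass ℂ A A] in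
/-- The action of a fixed algebra element on a normed module is continuous. -/
theorem NormedMod.continuous_smul (M : NormedMod A) (a : A) : Continuous (M.smul a) :=
  AddMonoidHomClass.continuous_of_bound (M.smulLM a) ‖a‖ (M.norm_smul_le a)

omit [IsScalarTower ℂ A A] [SMulCommClass ℂ A A] in
/-- A bounded operator which commutes with the action on a dense image of a module is a
morphism. -/
theorem IsMor.of_comp_denseRange {M N L : NormedMod A} {ι : M.X →L[ℂ] N.X} (hι : IsMor M N ι)
    (hd : DenseRange ι) {f : N.X →L[ℂ] L.X} (hf : IsMor M L (f.comp ι)) : IsMor N L f := by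
  intro a
  refine congrFun (hd.equalizer (f.continuous.comp (N.continuous_smul a))
    ((L.continuous_smul a).comp f.continuous) (funext fun x => ?_))
  have h := hf a x
  simp only [ContinuousLinearMap.comp_apply, hι a x] at h
  exact h

/-- A bounded operator into a Banach space extends, without increasing its norm, along an
isometric operator with dense range. -/
theorem exists_extension_of_isometric_denseRange {E F G : Type*} [NormedAddCommGroup E]
    [NormedSpace ℂ E] [NormedAddCommGroup F] [NormedSpace ℂ F] [NormedAddCommGroup G]
    [NormedSpace ℂ G] [CompleteSpace G] (ι : E →L[ℂ] F) (hι : ∀ x, ‖ι x‖ = ‖x‖)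
    (hd : DenseRange ι) (f : E →L[ℂ] G) :
    ∃ g : F →L[ℂ] G, g.comp ι = f ∧ ‖g‖ ≤ ‖f‖ := by
  have hiso : Isometry ι := AddMonoidHomClass.isometry_of_norm ι hι
  refine ⟨f.extend ι, ContinuousLinearMap.ext fun x =>
    f.extend_eq hd hiso.isUniformInducing x, ?_⟩
  simpa using f.opNorm_extend_le (N := 1) hd fun x => by simp [hι x]

/-- Proposition 1.2: if every module of the class `K` has its completion in `K`, then the
completion of a module which is extremely projective with respect to `K` is extremely
projective with respect to the class `K̄` of Banach `A`-modules arising as completions of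
modules from `K`. -/
theorem completion_extremelyProjective
    (K : NormedMod A → Prop)
    (hK : ∀ M : NormedMod A, K M → ∀ N : NormedMod A, IsCompletionOf M N → K N)
    (P : NormedMod A) (hP : ExtremelyProjective P K)
    (Pbar : NormedMod A) (hPbar : IsCompletionOf P Pbar) :
    ExtremelyProjective Pbar
      (fun N => ∃ M : NormedMod A, K M ∧ IsCompletionOf M N) := by
  intro MY MX hY hX τ hτ hco φ hφ ε hε
  obtain ⟨_, ι, hι, hnorm, hd⟩ := hPbar
  obtain ⟨Y₀, hY₀, hYc⟩ := hY
  obtain ⟨X₀, hX₀, hXc⟩ := hX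
  have hφι : IsMor P MX (φ.comp ι) := fun a x => by
    rw [ContinuousLinearMap.comp_apply, hι a x, hφ]
    rfl
  have hφn : ‖φ.comp ι‖ ≤ ‖φ‖ :=
    ContinuousLinearMap.opNorm_le_bound _ (norm_nonneg φ) fun x =>
      (φ.le_opNorm (ι x)).trans_eq (by rw [hnorm])
  obtain ⟨ψ₀, hψ₀, hτψ₀, hψ₀n⟩ :=
    hP MY MX (hK Y₀ hY₀ MY hYc) (hK X₀ hX₀ MX hXc) τ hτ hco (φ.comp ι) hφι ε hε
  have := hYc.1
  obtain ⟨ψ, hψι, hψn⟩ := exists_extension_of_isometric_denseRange ι hnorm hd ψ₀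
  refine ⟨ψ, hι.of_comp_denseRange hd (hψι ▸ hψ₀), ?_, by linarith⟩
  refine ContinuousLinearMap.ext (congrFun (hd.equalizer (τ.comp ψ).continuous φ.continuous ?_))
  funext x
  have h₁ := DFunLike.congr_fun hτψ₀ x
  rw [← hψι] at h₁
  exact h₁

end
end

section
/- Let A be a sequence algebra and X an essential homogeneous normed A-module. Then for every x ∈ X one has x = lim_{N→∞} Pᴺ·x, where Pᴺ := p¹ + p² + ... + pᴺ ∈ A. -/
noncomputable section

open Filter Topology

variable {A : Type} [NonUnitalNormedRing A] [NormedSpace ℂ A]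
  [IsScalarTower ℂ A A] [SMulCommClass ℂ A A]

variable (SA : SequenceAlgebra A)

namespace SequenceAlgebra

omit [IsScalarTower ℂ A A] [SMulCommClass ℂ A A] in
lemma p_mul_p (n m : ℕ) : SA.p n * SA.p m = if n = m then SA.p m else 0 := by
  apply SA.coords_injective
  rw [SA.coords_mul]
  split_ifs with h
  · subst h
    ext k
    simp [SA.coords_p]
  · ext k
    simp only [SA.coords_p, Pi.mul_apply, map_zero, Pi.zero_apply]
    split_ifs <;> simp_all

omit [IsScalarTower ℂ A A] [SMulCommClass ℂ A A] in
lemma p_mul_sum_p (k N : ℕ) :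
    SA.p k * ∑ n ∈ Finset.range N, SA.p n = if k < N then SA.p k else 0 := by
  rw [Finset.mul_sum]
  simp [p_mul_p]

omit [IsScalarTower ℂ A A] [SMulCommClass ℂ A A] in
lemma sum_p_mul_p (k N : ℕ) :
    (∑ n ∈ Finset.range N, SA.p n) * SA.p k = if k < N then SA.p k else 0 := by
  rw [Finset.sum_mul]
  simp [p_mul_p]

end SequenceAlgebra

namespace NormedMod

/-- The action of `A` on a fixed element `x` of a normed `A`-module, as a continuous linear map. -/
def orbitCLM (M : NormedMod A) (x : M.X) : A →L[ℂ] M.X :=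
  LinearMap.mkContinuous
    { toFun := fun a => M.smul a x
      map_add' := fun a b => M.add_smul a b x
      map_smul' := fun c a => M.csmul_smul c a x }
    ‖x‖ fun a => (M.norm_smul_le a x).trans_eq (mul_comm _ _)

omit [IsScalarTower ℂ A A] [SMulCommClass ℂ A A] in
lemma zero_smul (M : NormedMod A) (x : M.X) : M.smul 0 x = 0 :=
  map_zero (M.orbitCLM x)

end NormedMod

omit [IsScalarTower ℂ A A] [SMulCommClass ℂ A A] in
variable {SA} in
lemma Homogeneous.norm_smul_sum_p_le {M : NormedMod A} (hhom : Homogeneous SA M) (N : ℕ)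
    (x : M.X) : ‖M.smul (∑ n ∈ Finset.range N, SA.p n) x‖ ≤ ‖x‖ := by
  refine hhom _ _ fun k => ?_
  rw [← M.mul_smul, SA.p_mul_sum_p]
  split_ifs
  · exact le_rfl
  · rw [M.zero_smul, norm_zero]
    exact norm_nonneg _

/-- The elements `x` of a normed `A`-module for which `Pᴺ · x` tends to `x`. -/
def truncationLimitSub (M : NormedMod A) : Submodule ℂ M.X where
  carrier := {x | Tendsto (fun N : ℕ => M.smul (∑ n ∈ Finset.range N, SA.p n) x) atTop (𝓝 x)}
  add_mem' {x y} hx hy := by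
    simpa only [Set.mem_ofPred_eq, M.smul_add] using Tendsto.add hx hy
  zero_mem' := by
    simpa only [Set.mem_ofPred_eq, show ∀ a, M.smul a 0 = 0 from fun a => map_zero (M.smulLM a)]
      using tendsto_const_nhds
  smul_mem' c x hx := by
    simpa only [Set.mem_ofPred_eq, M.smul_csmul] using Tendsto.const_smul hx c

omit [IsScalarTower ℂ A A] [SMulCommClass ℂ A A] in
lemma smul_p_mem_truncationLimitSub (M : NormedMod A) (k : ℕ) (x : M.X) :
    M.smul (SA.p k) x ∈ truncationLimitSub SA M := by
  refine tendsto_const_nhds.congr' ?_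
  filter_upwards [eventually_gt_atTop k] with N hN
  rw [← M.mul_smul, SA.sum_p_mul_p, if_pos hN]

omit [IsScalarTower ℂ A A] [SMulCommClass ℂ A A] in
variable {SA} in
lemma Homogeneous.isClosed_truncationLimitSub {M : NormedMod A} (hhom : Homogeneous SA M) :
    IsClosed (truncationLimitSub SA M : Set M.X) := by
  refine (LipschitzWith.uniformEquicontinuous
    (fun (N : ℕ) (x : M.X) => M.smul (∑ n ∈ Finset.range N, SA.p n) x) 1
    fun N => ?_).equicontinuous.isClosed_setOfPred_tendsto continuous_id
  exact AddMonoidHomClass.lipschitz_of_bound_nnnorm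
    (M.smulLM (∑ n ∈ Finset.range N, SA.p n)) 1
    fun x => by simpa using! hhom.norm_smul_sum_p_le N x

omit [IsScalarTower ℂ A A] [SMulCommClass ℂ A A] in
variable {SA} in
lemma Homogeneous.smul_mem_truncationLimitSub {M : NormedMod A} (hhom : Homogeneous SA M)
    (a : A) (x : M.X) : M.smul a x ∈ truncationLimitSub SA M := by
  have hspan : Submodule.span ℂ (Set.range SA.p) ≤
      (truncationLimitSub SA M).comap (M.orbitCLM x).toLinearMap := by
    rw [Submodule.span_le]
    rintro _ ⟨k, rfl⟩
    exact smul_p_mem_truncationLimitSub SA M k x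
  have hclosed := hhom.isClosed_truncationLimitSub.preimage (M.orbitCLM x).continuous
  exact closure_minimal hspan hclosed (SA.dense_c00 a)

/-- Proposition 1.5: in an essential homogeneous normed module over a sequence algebra,
every element is the limit of `Pᴺ · x`, where `Pᴺ = p¹ + ⋯ + pᴺ`. -/
theorem essential_homogeneous_tendsto
    (M : NormedMod A) (hess : M.Essential) (hhom : Homogeneous SA M) (x : M.X) :
    Filter.Tendsto (fun N : ℕ => M.smul (∑ n ∈ Finset.range N, SA.p n) x)
      Filter.atTop (nhds x) := by
  have hspan : Submodule.span ℂ {y : M.X | ∃ (a : A) (x : M.X), y = M.smul a x} ≤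
      truncationLimitSub SA M := by
    rw [Submodule.span_le]
    rintro _ ⟨a, y, rfl⟩
    exact hhom.smul_mem_truncationLimitSub a y
  exact closure_minimal hspan hhom.isClosed_truncationLimitSub (hess x)

end
end
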